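/- Let p be a real polynomial of degree d > 1 whose Julia set J(p) is real, and let ξ = max J(p) (or ξ = min J(p)) be a fixed point of p. Then |p'(ξ)| ≥ d². -/

import Mathlib

/-- The filled Julia set of a polynomial: points with bounded forward orbit. -/
def filledJuliaSet (p : Polynomial ℂ) : Set ℂ :=
  {z | Bornology.IsBounded (Set.range fun n => (fun w => p.eval w)^[n] z)}

/-- The Julia set of a polynomial, as the boundary of the filled Julia set. -/
def juliaSet (p : Polynomial ℂ) : Set ℂ := frontier (filledJuliaSet p)

open Polynomial in
theorem core_count (q F : ℝ[X]) (d : ℕ) (hd : 1 ≤ d) (hq : q.natDegree = d)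
    (h1 : (q - C 1).roots.card = d) (h2 : (q - C (-1)).roots.card = d)
    (hb1 : ∀ x ∈ (q - C 1).roots, x ∈ Set.Icc (-1:ℝ) 1)
    (hb2 : ∀ x ∈ (q - C (-1)).roots, x ∈ Set.Icc (-1:ℝ) 1)
    (hF0 : F ≠ 0) (hFd : F.natDegree ≤ d)
    (hFp : ∀ x ∈ Set.Icc (-1:ℝ) 1, q.eval x = 1 → 0 < F.eval x)
    (hFn : ∀ x ∈ Set.Icc (-1:ℝ) 1, q.eval x = -1 → F.eval x < 0)
    (hq1 : q.eval 1 = 1)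
    (z0 : ℝ) (hz0 : 1 < z0) (hFz : F.eval z0 = 0) : False := by
  classical
  have hne : ∀ w : ℝ, q - C w ≠ 0 := by
    intro w h
    have : q = C w := sub_eq_zero.mp h
    rw [this, natDegree_C] at hq
    omega
  have hmem : ∀ w x : ℝ, x ∈ (q - C w).roots ↔ q.eval x = w := by
    intro w x
    rw [mem_roots (hne w)]
    simp [IsRoot, sub_eq_zero]
  set S1 := (q - C 1).roots.toFinset with hS1
  set S2 := (q - C (-1)).roots.toFinset with hS2
  have hm1 : ∀ x, x ∈ S1 ↔ q.eval x = 1 := fun x => by rw [hS1, Multiset.mem_toFinset, hmem]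
  have hm2 : ∀ x, x ∈ S2 ↔ q.eval x = -1 := fun x => by rw [hS2, Multiset.mem_toFinset, hmem]
  have hdisj : Disjoint S1 S2 := by
    rw [Finset.disjoint_left]
    intro x hx hx'
    rw [hm1] at hx
    rw [hm2] at hx'
    linarith
  set S := S1 ∪ S2 with hS
  have hSI : ∀ x ∈ S, x ∈ Set.Icc (-1:ℝ) 1 := by
    intro x hx
    rcases Finset.mem_union.mp hx with h | h
    · exact hb1 x (Multiset.mem_toFinset.mp h)
    · exact hb2 x (Multiset.mem_toFinset.mp h)
  have h1S : (1:ℝ) ∈ S := Finset.mem_union_left _ ((hm1 1).2 hq1)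
  have hval : ∀ x ∈ S, q.eval x = 1 ∨ q.eval x = -1 := by
    intro x hx
    rcases Finset.mem_union.mp hx with h | h
    · exact Or.inl ((hm1 x).1 h)
    · exact Or.inr ((hm2 x).1 h)
  -- choice of intermediate points
  have hc : ∀ s ∈ S.erase 1, ∃ c, s < c ∧ (∀ t ∈ S, s < t → c < t) ∧
      (F.eval c = 0 ∨ (derivative q).eval c = 0) := by
    intro s hs
    obtain ⟨hs1, hsS⟩ := Finset.mem_erase.mp hs
    have hslt : s < 1 := lt_of_le_of_ne (hSI s hsS).2 hs1
    have hne' : (S.filter (fun t => s < t)).Nonempty := ⟨1, by simp [h1S, hslt]⟩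
    set t := (S.filter (fun t => s < t)).min' hne' with ht
    have htm := Finset.min'_mem _ hne'
    rw [← ht, Finset.mem_filter] at htm
    have hmin : ∀ u ∈ S, s < u → t ≤ u := fun u hu hsu =>
      Finset.min'_le _ _ (by simp [hu, hsu])
    have key : ∃ c ∈ Set.Ioo s t, F.eval c = 0 ∨ (derivative q).eval c = 0 := by
      have rolle : q.eval s = q.eval t → ∃ c ∈ Set.Ioo s t, F.eval c = 0 ∨ (derivative q).eval c = 0 := by
        intro h
        obtain ⟨c, hc, h⟩ := exists_hasDerivAt_eq_zero htm.2 q.continuousOn h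
          (fun x _ => q.hasDerivAt x)
        exact ⟨c, hc, Or.inr h⟩
      rcases hval s hsS with h | h <;> rcases hval t htm.1 with h' | h'
      · exact rolle (h.trans h'.symm)
      · obtain ⟨c, hc, h0⟩ := intermediate_value_Ioo' htm.2.le F.continuousOn
          (⟨hFn t (hSI t htm.1) h', hFp s (hSI s hsS) h⟩ : (0:ℝ) ∈ Set.Ioo _ _)
        exact ⟨c, hc, Or.inl h0⟩
      · obtain ⟨c, hc, h0⟩ := intermediate_value_Ioo htm.2.le F.continuousOn
          (⟨hFn s (hSI s hsS) h, hFp t (hSI t htm.1) h'⟩ : (0:ℝ) ∈ Set.Ioo _ _)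
        exact ⟨c, hc, Or.inl h0⟩
      · exact rolle (h.trans h'.symm)
    obtain ⟨c, hc, h⟩ := key
    exact ⟨c, hc.1, fun u hu hsu => lt_of_lt_of_le hc.2 (hmin u hu hsu), h⟩
  choose! c hc1 hc2 hc3 using hc
  have hsub : ∀ s ∈ S.erase 1, s ∈ S := fun s hs => Finset.mem_of_mem_erase hs
  have hinj : Set.InjOn c (S.erase 1 : Finset ℝ) := by
    intro s hs t ht h
    rw [Finset.mem_coe] at hs ht
    rcases lt_trichotomy s t with hlt | heq | hlt
    · have := hc2 s hs t (hsub t ht) hlt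
      have := hc1 t ht
      linarith
    · exact heq
    · have := hc2 t ht s (hsub s hs) hlt
      have := hc1 s hs
      linarith
  have hcS : ∀ s ∈ S.erase 1, c s ∉ S := fun s hs h => lt_irrefl _ (hc2 s hs _ h (hc1 s hs))
  have hclt : ∀ s ∈ S.erase 1, c s < 1 := by
    intro s hs
    exact hc2 s hs 1 h1S (lt_of_le_of_ne (hSI s (hsub s hs)).2 (Finset.ne_of_mem_erase hs))
  set P := (S.erase 1).filter (fun s => F.eval (c s) = 0) with hP
  set D := (S.erase 1).filter (fun s => (derivative q).eval (c s) = 0) with hD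
  have hPD : S.card ≤ P.card + D.card + 1 := by
    have : S.erase 1 ⊆ P ∪ D := by
      intro s hs
      rw [Finset.mem_union, hP, hD, Finset.mem_filter, Finset.mem_filter]
      rcases hc3 s hs with h | h
      · exact Or.inl ⟨hs, h⟩
      · exact Or.inr ⟨hs, h⟩
    have h3 := (Finset.card_le_card this).trans (Finset.card_union_le _ _)
    rw [Finset.card_erase_of_mem h1S] at h3
    omega
  have hPc : P.card + 1 ≤ d := by
    have hi : Set.InjOn c P := hinj.mono (by
      intro x hx; exact (Finset.mem_filter.mp hx).1)
    have : insert z0 (P.image c) ⊆ F.roots.toFinset := by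
      intro x hx
      rw [Multiset.mem_toFinset, mem_roots hF0]
      rcases Finset.mem_insert.mp hx with rfl | hx
      · exact hFz
      · obtain ⟨s, hs, rfl⟩ := Finset.mem_image.mp hx
        exact (Finset.mem_filter.mp hs).2
    have h3 := Finset.card_le_card this
    rw [Finset.card_insert_of_notMem, Finset.card_image_of_injOn hi] at h3
    · exact h3.trans ((Multiset.toFinset_card_le _).trans ((card_roots' F).trans hFd))
    · intro hx
      obtain ⟨s, hs, h⟩ := Finset.mem_image.mp hx
      have := hclt s (Finset.mem_filter.mp hs).1
      linarith
  have hq' : derivative q ≠ 0 := by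
    intro h
    have := derivative_eq_zero.1 h
    omega
  have hDc : 2 * d + D.card ≤ S.card + (d - 1) := by
    have hi : Set.InjOn c D := hinj.mono (by
      intro x hx; exact (Finset.mem_filter.mp hx).1)
    have hdis2 : Disjoint S (D.image c) := by
      rw [Finset.disjoint_right]
      intro x hx
      obtain ⟨s, hs, rfl⟩ := Finset.mem_image.mp hx
      exact hcS s (Finset.mem_filter.mp hs).1
    have hsum : ∀ w : ℝ, (q - C w).roots.card =
        (q - C w).roots.toFinset.card +
        ∑ x ∈ (q - C w).roots.toFinset, (derivative q).roots.count x := by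
      intro w
      rw [← Multiset.toFinset_sum_count_eq, Finset.card_eq_sum_ones, ← Finset.sum_add_distrib]
      refine Finset.sum_congr rfl fun x hx => ?_
      have hr : (q - C w).IsRoot x := (mem_roots (hne w)).1 (Multiset.mem_toFinset.mp hx)
      have hpos := (rootMultiplicity_pos (hne w)).2 hr
      have := derivative_rootMultiplicity_of_root hr
      rw [derivative_sub, derivative_C, sub_zero] at this
      rw [count_roots, count_roots, this]
      omega
    have e1 := hsum 1
    have e2 := hsum (-1)
    rw [h1] at e1
    rw [h2] at e2
    rw [← hS1] at e1
    rw [← hS2] at e2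
    have hcard : S.card = S1.card + S2.card := Finset.card_union_of_disjoint hdisj
    have hss : ∑ x ∈ S, (derivative q).roots.count x =
      ∑ x ∈ S1, (derivative q).roots.count x + ∑ x ∈ S2, (derivative q).roots.count x :=
      Finset.sum_union hdisj
    have hD2 : D.card ≤ ∑ x ∈ D.image c, (derivative q).roots.count x := by
      rw [← Finset.card_image_of_injOn hi, Finset.card_eq_sum_ones]
      refine Finset.sum_le_sum fun x hx => ?_
      obtain ⟨s, hs, rfl⟩ := Finset.mem_image.mp hx
      rw [Nat.one_le_iff_ne_zero, Multiset.count_ne_zero, mem_roots hq']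
      exact (Finset.mem_filter.mp hs).2
    have htot : ∑ x ∈ S ∪ D.image c, (derivative q).roots.count x ≤ (derivative q).roots.card := by
      rw [← Multiset.toFinset_sum_count_eq]
      refine Finset.sum_le_sum_of_ne_zero ?_
      intro x _ hx
      exact Multiset.mem_toFinset.mpr (Multiset.count_ne_zero.mp hx)
    rw [Finset.sum_union hdis2] at htot
    have := card_roots' (derivative q)
    have := natDegree_derivative_le q
    omega
  omega

open Polynomial in
theorem core_deriv (q : ℝ[X]) (d : ℕ) (hd : 1 ≤ d) (hq : q.natDegree = d)
    (h1 : (q - C 1).roots.card = d) (h2 : (q - C (-1)).roots.card = d)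
    (hb1 : ∀ x ∈ (q - C 1).roots, x ∈ Set.Icc (-1:ℝ) 1)
    (hb2 : ∀ x ∈ (q - C (-1)).roots, x ∈ Set.Icc (-1:ℝ) 1)
    (hq1 : q.eval 1 = 1) : (d:ℝ)^2 ≤ (derivative q).eval 1 := by
  by_contra! hlt
  set T := Chebyshev.T ℝ d with hT
  have hT1 : T.eval 1 = 1 := Chebyshev.T_eval_one ℝ _
  have hT' : (derivative T).eval 1 = (d:ℝ)^2 := by
    rw [hT, Chebyshev.derivative_T_eval_one]; simp
  have hTd : T.natDegree = d := by
    rw [hT, Chebyshev.natDegree_T]; simp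
  obtain ⟨x, hx1, hx⟩ : ∃ x : ℝ, 1 < x ∧ q.eval x < T.eval x := by
    have hD : HasDerivAt (fun x => (T - q).eval x) ((derivative (T - q)).eval 1) 1 :=
      (T - q).hasDerivAt 1
    have hpos : 0 < (derivative (T - q)).eval 1 := by
      rw [derivative_sub, eval_sub, hT']; linarith
    have := hD.tendsto_slope.mono_left (nhdsGT_le_nhdsNE 1)
    have h3 := (this.eventually (lt_mem_nhds hpos)).and self_mem_nhdsWithin
    obtain ⟨x, hx, hx1⟩ := h3.exists
    refine ⟨x, hx1, ?_⟩
    have hx1' : (0:ℝ) < x - 1 := sub_pos.2 hx1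
    rw [slope_def_field] at hx
    simp only [eval_sub, hT1, hq1, sub_self, sub_zero] at hx
    have := (div_pos_iff_of_pos_right hx1').1 hx
    linarith
  obtain ⟨r, hr0, hr1, hr⟩ : ∃ r : ℝ, 0 ≤ r ∧ r < 1 ∧ q.eval x < r * T.eval x := by
    have hcont : Filter.Tendsto (fun r : ℝ => r * T.eval x) (nhdsWithin 1 (Set.Iio 1))
        (nhds (1 * T.eval x)) :=
      ((continuous_id.mul continuous_const).tendsto 1).mono_left nhdsWithin_le_nhds
    have ha := hcont.eventually (lt_mem_nhds (by rw [one_mul]; exact hx))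
    have hb : ∀ᶠ r : ℝ in nhdsWithin 1 (Set.Iio 1), (0:ℝ) < r :=
      nhdsWithin_le_nhds (lt_mem_nhds one_pos)
    obtain ⟨r, ⟨h, h'⟩, h''⟩ := ((ha.and hb).and self_mem_nhdsWithin).exists
    exact ⟨r, h'.le, h'', h⟩
  set F := q - C r * T with hF
  have hFe : ∀ y, F.eval y = q.eval y - r * T.eval y := fun y => by simp [hF]
  have hF1 : 0 < F.eval 1 := by rw [hFe, hq1, hT1]; linarith
  have hFx : F.eval x < 0 := by rw [hFe]; linarith
  obtain ⟨z0, hz, hz0⟩ := intermediate_value_Ioo' hx1.le F.continuousOn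
    (⟨hFx, hF1⟩ : (0:ℝ) ∈ Set.Ioo _ _)
  have hTb : ∀ y ∈ Set.Icc (-1:ℝ) 1, |r * T.eval y| < 1 := by
    intro y hy
    have := Chebyshev.abs_eval_T_real_le_one d (abs_le.2 hy)
    rw [abs_mul, abs_of_nonneg hr0]
    nlinarith [abs_nonneg (T.eval y)]
  refine core_count q F d hd hq h1 h2 hb1 hb2 (by intro h; simp [h] at hF1) ?_ ?_ ?_ hq1 z0 hz.1 hz0
  · refine (natDegree_sub_le _ _).trans (max_le hq.le ?_)
    exact (natDegree_C_mul_le _ _).trans hTd.le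
  · intro y hy h
    have := abs_lt.1 (hTb y hy)
    rw [hFe, h]; linarith
  · intro y hy h
    have := abs_lt.1 (hTb y hy)
    rw [hFe, h]; linarith

open Polynomial in
theorem conj_deriv (p : ℝ[X]) (d : ℕ) (hd : 1 ≤ d) (hp : p.natDegree = d) (ξ η : ℝ)
    (hne : ξ ≠ η) (hfix : p.eval ξ = ξ) (hs1 : (p - C ξ).Splits) (hs2 : (p - C η).Splits)
    (hb : ∀ x, p.eval x = ξ ∨ p.eval x = η → x ∈ Set.uIcc η ξ) :
    (d:ℝ)^2 ≤ (derivative p).eval ξ := by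
  obtain ⟨α, hα⟩ : ∃ α, α = (ξ - η) / 2 := ⟨_, rfl⟩
  obtain ⟨β, hβ⟩ : ∃ β, β = (ξ + η) / 2 := ⟨_, rfl⟩
  have hα0 : α ≠ 0 := by
    rw [hα]
    have := sub_ne_zero.2 hne
    simpa using this
  set L : ℝ[X] := C α * X + C β with hL
  have hLd : L.natDegree = 1 := natDegree_linear hα0
  set q : ℝ[X] := C α⁻¹ * (p.comp L - C β) with hq
  have hqe : ∀ x, q.eval x = α⁻¹ * (p.eval (α * x + β) - β) := by
    intro x; simp [hq, hL]
  have hqw : ∀ w v, α * w + β = v → q - C w = C α⁻¹ * (p - C v).comp L := by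
    intro w v h
    rw [hq, ← h, sub_comp, C_comp]
    have hcc : C α⁻¹ * C α = (1 : ℝ[X]) := by rw [← C_mul, inv_mul_cancel₀ hα0, C_1]
    rw [C_add, C_mul]
    linear_combination (C w) * hcc
  have hqd : q.natDegree = d := by
    rw [hq, natDegree_C_mul (inv_ne_zero hα0), natDegree_sub_C, natDegree_comp, hp, hLd, mul_one]
  have hcard : ∀ w v, α * w + β = v → (p - C v).Splits → (q - C w).roots.card = d := by
    intro w v h hs
    rw [← hqd, ← natDegree_sub_C (a := w), ← splits_iff_card_roots, hqw w v h]
    exact (Splits.C _).mul (hs.comp_of_natDegree_le_one hLd.le)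
  have e1 : α * 1 + β = ξ := by rw [hα, hβ]; ring
  have e2 : α * (-1) + β = η := by rw [hα, hβ]; ring
  have hI : ∀ w x, (w = 1 ∨ w = -1) → x ∈ (q - C w).roots → x ∈ Set.Icc (-1:ℝ) 1 := by
    intro w x hw hx
    have hx' := (mem_roots'.1 hx).2
    rw [IsRoot, eval_sub, eval_C, hqe, sub_eq_zero, inv_mul_eq_iff_eq_mul₀ hα0] at hx'
    have hm : α * x + β ∈ Set.uIcc η ξ := by
      apply hb
      rcases hw with rfl | rfl
      · left; linarith
      · right; linarith
    rw [Set.mem_uIcc] at hm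
    have hξ : ξ = α + β := by linarith
    have hη : η = -α + β := by linarith
    rw [hξ, hη] at hm
    rcases hm with ⟨h, h'⟩ | ⟨h, h'⟩
    · have : 0 < α := lt_of_le_of_ne (by linarith) hα0.symm
      constructor
      · by_contra hc
        nlinarith
      · by_contra hc
        nlinarith
    · have : α < 0 := lt_of_le_of_ne (by linarith) hα0
      constructor
      · by_contra hc
        nlinarith
      · by_contra hc
        nlinarith
  have hmain := core_deriv q d hd hqd (hcard 1 ξ e1 hs1) (hcard (-1) η e2 hs2)
    (fun x => hI 1 x (Or.inl rfl)) (fun x => hI (-1) x (Or.inr rfl))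
    (by rw [hqe, e1, hfix, inv_mul_eq_iff_eq_mul₀ hα0]; linarith)
  have : (derivative q).eval 1 = (derivative p).eval ξ := by
    rw [hq, derivative_C_mul, derivative_sub, derivative_C, sub_zero, derivative_comp]
    have : L.eval 1 = ξ := by simp [hL]; linarith
    have h2 : derivative L = C α := by simp [hL]
    rw [eval_mul, eval_C, eval_mul, eval_comp, this, h2, eval_C]
    field_simp
  rw [← this]
  exact hmain

open Polynomial in
theorem escape_radius (P : ℂ[X]) (hP : 1 < P.natDegree) :
    ∃ R : ℝ, 1 ≤ R ∧ ∀ z, R < ‖z‖ → 2 * ‖z‖ ≤ ‖P.eval z‖ := by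
  have hdeg : (X : ℂ[X]).degree < P.degree := by
    rw [degree_X]
    have h0 : P ≠ 0 := by rintro rfl; simp at hP
    rw [degree_eq_natDegree h0]
    exact_mod_cast hP
  have h := (isLittleO_cobounded_of_degree_lt hdeg).bound (show (0:ℝ) < 1/2 by norm_num)
  rw [← comap_norm_atTop, Filter.eventually_comap] at h
  obtain ⟨R, hR⟩ := Filter.eventually_atTop.1 h
  refine ⟨max R 1, le_max_right _ _, fun z hz => ?_⟩
  have := hR ‖z‖ ((le_max_left _ _).trans hz.le) z rfl
  rw [eval_X] at this
  linarith

open Polynomial in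
theorem filled_eq (P : ℂ[X]) (hP : 1 < P.natDegree) :
    ∃ R : ℝ, filledJuliaSet P = {z | ∀ n, ‖(fun w => P.eval w)^[n] z‖ ≤ R} := by
  obtain ⟨R, hR1, hR⟩ := escape_radius P hP
  refine ⟨R, ?_⟩
  ext z
  simp only [filledJuliaSet, Set.mem_ofPred_eq]
  constructor
  · intro hb n
    by_contra! hn
    obtain ⟨B, hB⟩ := hb.exists_norm_le
    have hgrow : ∀ k, R < ‖(fun w => P.eval w)^[n + k] z‖ ∧
        2 ^ k ≤ ‖(fun w => P.eval w)^[n + k] z‖ := by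
      intro k
      induction k with
      | zero => exact ⟨hn, by rw [pow_zero]; exact hR1.trans hn.le⟩
      | succ k ih =>
        have := hR _ ih.1
        rw [← add_assoc, Function.iterate_succ_apply', pow_succ]
        have h0 := norm_nonneg ((fun w => P.eval w)^[n + k] z)
        exact ⟨by linarith [ih.1], by linarith [ih.2]⟩
    obtain ⟨k, hk⟩ := pow_unbounded_of_one_lt B (show (1:ℝ) < 2 by norm_num)
    have := hB _ ⟨n + k, rfl⟩
    have := (hgrow k).2
    simp only at *
    linarith
  · intro h
    rw [isBounded_iff_forall_norm_le]
    exact ⟨R, by rintro _ ⟨n, rfl⟩; exact h n⟩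

open Polynomial in
theorem filled_closed (P : ℂ[X]) (hP : 1 < P.natDegree) : IsClosed (filledJuliaSet P) := by
  obtain ⟨R, h⟩ := filled_eq P hP
  rw [h, Set.setOf_forall]
  refine isClosed_iInter fun n => ?_
  exact isClosed_le ((P.continuous.iterate n).norm) continuous_const

open Polynomial in
theorem filled_bounded (P : ℂ[X]) (hP : 1 < P.natDegree) :
    ∃ R : ℝ, ∀ z ∈ filledJuliaSet P, ‖z‖ ≤ R := by
  obtain ⟨R, h⟩ := filled_eq P hP
  exact ⟨R, fun z hz => by rw [h] at hz; exact hz 0⟩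

open Polynomial in
theorem filled_preimage (P : ℂ[X]) (z : ℂ) (h : P.eval z ∈ filledJuliaSet P) :
    z ∈ filledJuliaSet P := by
  simp only [filledJuliaSet, Set.mem_ofPred_eq] at *
  refine (h.insert z).subset ?_
  rintro _ ⟨n, rfl⟩
  cases n with
  | zero => exact Set.mem_insert _ _
  | succ n => exact Set.mem_insert_of_mem _ ⟨n, by simp [Function.iterate_succ_apply]⟩

open Polynomial in
theorem filled_fixed (P : ℂ[X]) (z : ℂ) (h : P.eval z = z) :
    z ∈ filledJuliaSet P := by
  simp only [filledJuliaSet, Set.mem_ofPred_eq]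
  refine (Bornology.isBounded_singleton (x := z)).subset ?_
  rintro _ ⟨n, rfl⟩
  exact Function.iterate_fixed h n

open Polynomial in
theorem filled_real (P : ℂ[X]) (hP : 1 < P.natDegree)
    (hJ : ∀ z ∈ juliaSet P, z.im = 0) : ∀ z ∈ filledJuliaSet P, z.im = 0 := by
  obtain ⟨R, hR⟩ := filled_bounded P hP
  have key : ∀ U : Set ℂ, IsPreconnected U → (∀ z ∈ U, z.im ≠ 0) →
      (∃ z ∈ U, R < ‖z‖) → ∀ z ∈ U, z ∉ filledJuliaSet P := by
    rintro U hU hU0 ⟨w, hw, hwR⟩ z hz hzK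
    have hnf : ∀ u ∈ U, u ∈ filledJuliaSet P → u ∈ interior (filledJuliaSet P) := by
      intro u hu huK
      by_contra hi
      exact hU0 u hu (hJ u ⟨subset_closure huK, hi⟩)
    obtain ⟨u, _, hu1, hu2⟩ := hU (interior (filledJuliaSet P)) (filledJuliaSet P)ᶜ isOpen_interior
      (filled_closed P hP).isOpen_compl
      (fun u hu => by
        by_cases h : u ∈ filledJuliaSet P
        · exact Or.inl (hnf u hu h)
        · exact Or.inr h)
      ⟨z, hz, hnf z hz hzK⟩ ⟨w, hw, fun h => absurd (hR w h) (not_le.2 hwR)⟩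
    exact hu2 (interior_subset hu1)
  intro z hz
  by_contra hne
  rcases lt_or_gt_of_ne hne with h | h
  · refine key {z | z.im < 0} (convex_halfSpace_im_lt 0).isPreconnected
      (fun z hz => ne_of_lt hz) ⟨⟨0, -(|R| + 1)⟩, ?_, ?_⟩ z h hz
    · show -(|R| + 1) < 0
      linarith [abs_nonneg R]
    · have := Complex.abs_im_le_norm ⟨0, -(|R| + 1)⟩
      simp only [abs_neg] at this
      linarith [le_abs_self R, le_abs_self (|R| + 1)]
  · refine key {z | 0 < z.im} (convex_halfSpace_im_gt 0).isPreconnected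
      (fun z hz => ne_of_gt hz) ⟨⟨0, (|R| + 1)⟩, ?_, ?_⟩ z h hz
    · show 0 < (|R| + 1)
      linarith [abs_nonneg R]
    · have := Complex.abs_im_le_norm ⟨0, (|R| + 1)⟩
      simp only at this
      linarith [le_abs_self R, le_abs_self (|R| + 1)]

open Polynomial in
theorem julia_eq_filled (P : ℂ[X]) (hP : 1 < P.natDegree)
    (hJ : ∀ z ∈ juliaSet P, z.im = 0) : juliaSet P = filledJuliaSet P := by
  have hK := filled_real P hP hJ
  have hint : interior (filledJuliaSet P) = ∅ := by
    rw [Set.eq_empty_iff_forall_notMem]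
    intro z hz
    rw [mem_interior_iff_mem_nhds, Metric.mem_nhds_iff] at hz
    obtain ⟨ε, hε, hs⟩ := hz
    have h0 := hK z (hs (Metric.mem_ball_self hε))
    have h1 := hK (z + (ε / 2 : ℝ) * Complex.I) (hs (by
      rw [Metric.mem_ball, dist_eq_norm, add_sub_cancel_left, norm_mul, Complex.norm_I,
        Complex.norm_real, Real.norm_eq_abs, abs_of_pos (by positivity)]
      linarith))
    simp [h0] at h1
    linarith
  rw [juliaSet, frontier, hint, (filled_closed P hP).closure_eq, Set.diff_empty]

open Polynomial in
theorem exists_other (P : ℂ[X]) (hP : 1 < P.natDegree) (ξ : ℂ) (hfix : P.eval ξ = ξ) :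
    ∃ z ∈ filledJuliaSet P, z ≠ ξ := by
  by_contra! hall
  set Q := P - C ξ with hQ
  have hQd : Q.natDegree = P.natDegree := natDegree_sub_C
  have hsplit : Q.Splits := IsAlgClosed.splits Q
  have hroots : Q.roots = Multiset.replicate P.natDegree ξ := by
    rw [Multiset.eq_replicate, ← hQd]
    refine ⟨splits_iff_card_roots.1 hsplit, fun b hb => hall b (filled_preimage P b ?_)⟩
    have := (mem_roots'.1 hb).2
    rw [IsRoot, hQ, eval_sub, eval_C, sub_eq_zero] at this
    rw [this]
    exact filled_fixed P ξ hfix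
  have hQe : ∀ z, Q.eval z = Q.leadingCoeff * (z - ξ) ^ P.natDegree := by
    intro z
    conv_lhs => rw [hsplit.eq_prod_roots, hroots]
    simp
  have hc : Q.leadingCoeff ≠ 0 := by
    rw [leadingCoeff_ne_zero]
    intro h
    rw [h, natDegree_zero] at hQd
    omega
  obtain ⟨u, hu⟩ := IsAlgClosed.exists_pow_nat_eq (Q.leadingCoeff⁻¹)
    (show 0 < P.natDegree - 1 by omega)
  have hu0 : u ≠ 0 := by
    rintro rfl
    rw [zero_pow (by omega)] at hu
    exact inv_ne_zero hc hu.symm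
  have hfx : P.eval (ξ + u) = ξ + u := by
    have h1 := hQe (ξ + u)
    rw [add_sub_cancel_left] at h1
    have h2 : u ^ P.natDegree = u ^ (P.natDegree - 1) * u := by
      rw [← pow_succ]; congr 1; omega
    rw [h2, hu, ← mul_assoc, mul_inv_cancel₀ hc, one_mul, hQ, eval_sub, eval_C] at h1
    linear_combination h1
  have := hall _ (filled_fixed P _ hfx)
  exact hu0 (by simpa using this)

/-- If the maximum (or minimum) of a real Julia set is a fixed point of the real
polynomial `p` of degree `d > 1`, then its multiplier is at least `d²` in absolute
value. -/
theorem stmt_14 (p : Polynomial ℝ) (d : ℕ) (hd : 1 < d) (hdeg : p.natDegree = d)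
    (hJ : ∀ z ∈ juliaSet (p.map (algebraMap ℝ ℂ)), z.im = 0)
    (ξ : ℝ)
    (hξ : IsGreatest {x : ℝ | (x : ℂ) ∈ juliaSet (p.map (algebraMap ℝ ℂ))} ξ ∨
          IsLeast {x : ℝ | (x : ℂ) ∈ juliaSet (p.map (algebraMap ℝ ℂ))} ξ)
    (hfix : p.eval ξ = ξ) :
    ((d : ℝ)) ^ 2 ≤ |(Polynomial.derivative p).eval ξ| := by
  set P := p.map (algebraMap ℝ ℂ) with hPdef
  have hPd : 1 < P.natDegree := by
    rw [hPdef, Polynomial.natDegree_map, hdeg]; exact hd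
  have hPe : ∀ x : ℝ, P.eval (x : ℂ) = ((p.eval x : ℝ) : ℂ) := by
    intro x
    rw [hPdef]
    exact Polynomial.eval_map_apply (algebraMap ℝ ℂ) x
  rw [julia_eq_filled P hPd hJ] at hξ
  have hreal := filled_real P hPd hJ
  have hcast : ∀ z ∈ filledJuliaSet P, ((z.re : ℝ) : ℂ) = z := by
    intro z hz
    exact Complex.ext (by simp) (by simp [hreal z hz])
  set K : Set ℝ := {x : ℝ | (x : ℂ) ∈ filledJuliaSet P} with hK
  have hKcl : IsClosed K := (filled_closed P hPd).preimage Complex.continuous_ofReal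
  obtain ⟨R, hR⟩ := filled_bounded P hPd
  have hKR : ∀ x ∈ K, |x| ≤ R := by
    intro x hx
    have := hR _ hx
    rwa [Complex.norm_real, Real.norm_eq_abs] at this
  have hξK : ξ ∈ K := by
    rcases hξ with h | h <;> exact h.1
  have hne : K.Nonempty := ⟨ξ, hξK⟩
  have hbb : BddBelow K := ⟨-R, fun x hx => (abs_le.1 (hKR x hx)).1⟩
  have hba : BddAbove K := ⟨R, fun x hx => (abs_le.1 (hKR x hx)).2⟩
  obtain ⟨η, hηK, hη⟩ : ∃ η ∈ K, ∀ x ∈ K, x ∈ Set.uIcc η ξ := by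
    rcases hξ with h | h
    · exact ⟨sInf K, hKcl.csInf_mem hne hbb, fun x hx =>
        Set.Icc_subset_uIcc ⟨csInf_le hbb hx, h.2 hx⟩⟩
    · exact ⟨sSup K, hKcl.csSup_mem hne hba, fun x hx =>
        Set.Icc_subset_uIcc' ⟨h.2 hx, le_csSup hba hx⟩⟩
  have hneq : ξ ≠ η := by
    rintro rfl
    obtain ⟨z, hz, hzne⟩ := exists_other P hPd ξ (by rw [hPe, hfix])
    have := hη z.re (by rw [hK, Set.mem_ofPred_eq, hcast z hz]; exact hz)
    rw [Set.uIcc_self, Set.mem_singleton_iff] at this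
    exact hzne (by rw [← hcast z hz, this])
  have hpre : ∀ x : ℝ, p.eval x ∈ K → x ∈ K := by
    intro x hx
    apply filled_preimage
    rw [hPe]
    exact hx
  have hsplits : ∀ v ∈ K, (p - Polynomial.C v).Splits := by
    intro v hv
    refine Polynomial.Splits.of_splits_map_of_injective (i := algebraMap ℝ ℂ)
      (algebraMap ℝ ℂ).injective (IsAlgClosed.splits _) ?_
    intro a ha
    have := (Polynomial.mem_roots'.1 ha).2
    rw [Polynomial.map_sub, Polynomial.map_C, Polynomial.IsRoot, Polynomial.eval_sub,
      Polynomial.eval_C, sub_eq_zero] at this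
    have haK : a ∈ filledJuliaSet P := by
      apply filled_preimage
      rw [hPdef, this]
      exact hv
    exact ⟨a.re, hcast a haK⟩
  refine (conj_deriv p d hd.le hdeg ξ η hneq hfix (hsplits ξ hξK) (hsplits η hηK) ?_).trans
    (le_abs_self _)
  rintro x (h | h)
  · exact hη x (hpre x (by rw [h]; exact hξK))
  · exact hη x (hpre x (by rw [h]; exact hηK))
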